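/- Let Y be a finite-dimensional real normed space, E a normed space, X a convex subset of Y that is either closed and unbounded, or open, K ⊆ X a closed, bounded and convex set, and let g satisfy hypotheses (g0) and (g1) and be such that ψ_t² ∈ C(X;ℝ,g) for every t ∈ Y. For each n ≥ 1 let L_n : D(L_n) → F(K;E) be a linear operator dominated by a positive linear operator S_n : D(S_n) → F(K;ℝ), with C(X;E,g) ⊆ D(L_n) and C(X;ℝ,g) ⊆ D(S_n); set γ_n(t) := (S_n(ψ_t²)(t))^{1/2}. Let K₁ be a closed subset of the interior of K, and suppose that each L_n preserves the constants, that S_n(𝟙)(t) = 1 for all t ∈ K₁, and that S_n preserves the continuous linear functionals, i.e. S_n(φ|_X)(t) = φ(t) for every φ ∈ Y' and t ∈ K₁. Then for every F ∈ C(X;E,g) there exists a constant M > 0, depending only on F, K, K₁ and g, such that for all n ≥ 1 and all t ∈ K₁ with γ_n(t) > 0: ‖L_n(F)(t) − F(t)‖ ≤ 2·ω(F,γ_n(t)) + M·(S_n(g)(t) − g(t)), where ω(F,·) is the modulus of continuity of F restricted to K. -/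

import Mathlib

open Filter Topology Bornology

/-- Membership in `C(X;E,g)`: continuous on `X` with growth controlled by `g`. -/
def MemCg {Y E : Type*} [NormedAddCommGroup Y] [NormedAddCommGroup E]
    (X : Set Y) (g : Y → ℝ) (F : Y → E) : Prop :=
  ContinuousOn F X ∧ ∃ M > 0, ∀ u ∈ X, ‖F u‖ ≤ M * g u

/-- The modulus of continuity of `F` on `K`:
`ω(F,δ) = sup {‖F u − F t‖ : t, u ∈ K, ‖t − u‖ ≤ δ}`. -/
noncomputable def modulusOfContinuity {Y E : Type*} [NormedAddCommGroup Y]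
    [NormedAddCommGroup E] (K : Set Y) (F : Y → E) (δ : ℝ) : ℝ :=
  sSup {r : ℝ | ∃ t ∈ K, ∃ u ∈ K, ‖t - u‖ ≤ δ ∧ r = ‖F u - F t‖}

/-- The geometric setting of Theorem 4 (finite-dimensional case): `X ⊆ Y` convex and
either closed and unbounded or open, `K ⊆ X` closed, bounded and convex, and `g`
satisfying the hypotheses (g0) and (g1). -/
structure GSettingFin (Y : Type*) [NormedAddCommGroup Y] [NormedSpace ℝ Y] where
  X : Set Y
  K : Set Y
  g : Y → ℝ
  g' : Y → (Y →L[ℝ] ℝ)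
  conv : Convex ℝ X
  closed_unbounded_or_open : (IsClosed X ∧ ¬ IsBounded X) ∨ IsOpen X
  K_sub : K ⊆ X
  K_closed : IsClosed K
  K_bdd : IsBounded K
  K_conv : Convex ℝ K
  -- (g0)
  g_pos : ∀ u ∈ X, 0 < g u
  g_sconv : StrictConvexOn ℝ X g
  g_cont : ContinuousOn g X
  g_diff : ∀ t ∈ K, HasFDerivWithinAt g (g' t) X t
  g'_cont : ContinuousOn g' K
  -- (g1): with B_n := g⁻¹([0,n]) (as a subset of X)
  sublevel_K : ∀ n : ℕ, 1 ≤ n → K ⊆ X ∩ g ⁻¹' Set.Icc (0 : ℝ) (n : ℝ)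
  sublevel_bdd : ∀ n : ℕ, 1 ≤ n → IsBounded (X ∩ g ⁻¹' Set.Icc (0 : ℝ) (n : ℝ))
  sublevel_ne : ∀ n : ℕ, 1 ≤ n → (X \ (X ∩ g ⁻¹' Set.Icc (0 : ℝ) (n : ℝ))).Nonempty
  g_growth : ¬ IsBounded X →
    Tendsto (fun u => g u / ‖u‖) (comap (fun u : Y => ‖u‖) atTop ⊓ 𝓟 X) atTop

variable {Y : Type*} [NormedAddCommGroup Y] [NormedSpace ℝ Y]

/-- `h(t,u) = g(u) − [g(t) + ⟨g'(t), u − t⟩]`. -/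
noncomputable def GSettingFin.h (σ : GSettingFin Y) (t u : Y) : ℝ :=
  σ.g u - (σ.g t + σ.g' t (u - t))

section ModulusOfContinuity

variable {E : Type*} [NormedAddCommGroup E] {K : Set Y} {F : Y → E} {C δ : ℝ}

omit [NormedSpace ℝ Y] in
theorem norm_sub_le_modulusOfContinuity (hF : ∀ u ∈ K, ‖F u‖ ≤ C) {t u : Y} (ht : t ∈ K)
    (hu : u ∈ K) (h : ‖t - u‖ ≤ δ) : ‖F u - F t‖ ≤ modulusOfContinuity K F δ := by
  refine le_csSup ⟨C + C, ?_⟩ ⟨t, ht, u, hu, h, rfl⟩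
  rintro _ ⟨a, ha, b, hb, -, rfl⟩
  exact (norm_sub_le _ _).trans (add_le_add (hF b hb) (hF a ha))

omit [NormedSpace ℝ Y] in
theorem modulusOfContinuity_nonneg (K : Set Y) (F : Y → E) (δ : ℝ) :
    0 ≤ modulusOfContinuity K F δ := by
  refine Real.sSup_nonneg ?_
  rintro _ ⟨a, -, b, -, -, rfl⟩
  exact norm_nonneg _

theorem norm_sub_le_nat_mul_modulusOfContinuity (hK : Convex ℝ K) (hF : ∀ u ∈ K, ‖F u‖ ≤ C)
    {t : Y} (ht : t ∈ K) (N : ℕ) {u : Y} (hu : u ∈ K) (h : ‖t - u‖ ≤ N * δ) :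
    ‖F u - F t‖ ≤ N * modulusOfContinuity K F δ := by
  induction N generalizing u with
  | zero =>
    have : t = u := by simpa [sub_eq_zero] using h
    simp [this]
  | succ N ih =>
    have hN : (0 : ℝ) < N + 1 := by positivity
    push_cast at h ⊢
    have hle : ‖t - u‖ / (N + 1) ≤ δ := by
      rw [div_le_iff₀ hN]
      linarith
    set c : ℝ := N / (N + 1) with hc
    have hc0 : 0 ≤ c := by positivity
    have hc1 : 1 - c = 1 / (N + 1) := by
      rw [hc]
      field_simp
      ring
    set v := AffineMap.lineMap t u c with hv
    have hvK : v ∈ K := hK.lineMap_mem ht hu ⟨hc0, by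
      have : 0 < 1 - c := by rw [hc1]; positivity
      linarith⟩
    have htv : ‖t - v‖ ≤ N * δ := by
      rw [← dist_eq_norm, hv, dist_left_lineMap, Real.norm_of_nonneg hc0, dist_eq_norm]
      calc c * ‖t - u‖ = N * (‖t - u‖ / (N + 1)) := by rw [hc]; ring
        _ ≤ N * δ := by gcongr
    have hvu : ‖v - u‖ ≤ δ := by
      rw [← dist_eq_norm, hv, dist_lineMap_right, hc1, Real.norm_of_nonneg (by positivity),
        dist_eq_norm]
      calc 1 / ((N : ℝ) + 1) * ‖t - u‖ = ‖t - u‖ / (N + 1) := by ring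
        _ ≤ δ := hle
    calc ‖F u - F t‖ ≤ ‖F u - F v‖ + ‖F v - F t‖ := norm_sub_le_norm_sub_add_norm_sub _ _ _
      _ ≤ modulusOfContinuity K F δ + N * modulusOfContinuity K F δ :=
        add_le_add (norm_sub_le_modulusOfContinuity hF hvK hu hvu) (ih hvK htv)
      _ = (N + 1) * modulusOfContinuity K F δ := by ring

theorem norm_sub_le_one_add_sq_mul_modulusOfContinuity (hK : Convex ℝ K)
    (hF : ∀ u ∈ K, ‖F u‖ ≤ C) (hδ : 0 < δ) {t u : Y} (ht : t ∈ K) (hu : u ∈ K) :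
    ‖F u - F t‖ ≤ (1 + ‖u - t‖ ^ 2 / δ ^ 2) * modulusOfContinuity K F δ := by
  have hω := modulusOfContinuity_nonneg K F δ
  rw [← div_pow]
  set x := ‖u - t‖ / δ with hx
  have hxδ : ‖t - u‖ = x * δ := by rw [hx, norm_sub_rev, div_mul_cancel₀ _ hδ.ne']
  have hx0 : 0 ≤ x := by positivity
  obtain hx1 | hx1 := le_total x 1
  · calc ‖F u - F t‖ ≤ 1 * modulusOfContinuity K F δ := by
          rw [one_mul]
          exact norm_sub_le_modulusOfContinuity hF ht hu (by rw [hxδ]; nlinarith)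
      _ ≤ _ := by gcongr; nlinarith
  · calc ‖F u - F t‖ ≤ ⌈x⌉₊ * modulusOfContinuity K F δ := by
          refine norm_sub_le_nat_mul_modulusOfContinuity hK hF ht _ hu ?_
          rw [hxδ]
          gcongr
          exact Nat.le_ceil x
      _ ≤ _ := by
          gcongr
          nlinarith [Nat.ceil_lt_add_one hx0]

end ModulusOfContinuity

theorem MemCg.continuousLinearMap {X : Set Y} {g : Y → ℝ} (hg : ∃ C > 0, ∀ u ∈ X, 1 ≤ C * g u)
    (hsq : MemCg X g fun u => ‖u‖ ^ 2) (φ : Y →L[ℝ] ℝ) : MemCg X g fun u => φ u := by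
  obtain ⟨C, hC, hCg⟩ := hg
  obtain ⟨-, D, hD, hDg⟩ := hsq
  refine ⟨φ.continuous.continuousOn, (‖φ‖ + 1) * (C + D), by positivity, fun u hu => ?_⟩
  have h1 := hCg u hu
  have h2 : ‖u‖ ^ 2 ≤ D * g u := by simpa using hDg u hu
  have h3 : ‖u‖ ≤ (C + D) * g u := by nlinarith [sq_nonneg (‖u‖ - 1)]
  calc ‖φ u‖ ≤ ‖φ‖ * ‖u‖ := φ.le_opNorm u
    _ ≤ (‖φ‖ + 1) * ((C + D) * g u) := by
      gcongr
      linarith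
    _ = _ := by ring

omit [NormedSpace ℝ Y] in
/-- Two distinct points bound `g` below, because `‖u - a‖² + ‖u - b‖² ≥ ‖a - b‖² / 2`. -/
theorem exists_one_le_mul_of_memCg_sq_norm_sub [Nontrivial Y] {X : Set Y} {g : Y → ℝ}
    (hψ : ∀ t : Y, MemCg X g fun u => ‖u - t‖ ^ 2) : ∃ C > 0, ∀ u ∈ X, 1 ≤ C * g u := by
  obtain ⟨a, b, hab⟩ := exists_pair_ne Y
  obtain ⟨-, A, hA, hAg⟩ := hψ a
  obtain ⟨-, B, hB, hBg⟩ := hψ b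
  have hd : 0 < ‖a - b‖ := norm_pos_iff.2 (sub_ne_zero.2 hab)
  refine ⟨2 * (A + B) / ‖a - b‖ ^ 2, by positivity, fun u hu => ?_⟩
  have h1 : ‖u - a‖ ^ 2 ≤ A * g u := by simpa using hAg u hu
  have h2 : ‖u - b‖ ^ 2 ≤ B * g u := by simpa using hBg u hu
  have h3 : ‖a - b‖ ≤ ‖u - a‖ + ‖u - b‖ := by
    simpa [norm_sub_rev] using norm_sub_le_norm_sub_add_norm_sub a u b
  rw [div_mul_eq_mul_div, one_le_div (by positivity)]
  nlinarith [sq_nonneg (‖u - a‖ - ‖u - b‖), norm_nonneg (u - a), norm_nonneg (u - b)]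

namespace GSettingFin

theorem nontrivial (σ : GSettingFin Y) : Nontrivial Y := by
  by_contra hY
  rw [not_nontrivial_iff_subsingleton] at hY
  obtain ⟨a, ha, -⟩ := σ.sublevel_ne 1 le_rfl
  obtain ⟨n, hn⟩ := exists_nat_ge (σ.g a)
  obtain ⟨b, hb, hb'⟩ := σ.sublevel_ne (n + 1) (by simp)
  rw [Subsingleton.elim b a] at hb'
  refine hb' ⟨ha, (σ.g_pos a ha).le, ?_⟩
  push_cast
  linarith

variable {σ : GSettingFin Y}

theorem g_le_one {t : Y} (ht : t ∈ σ.K) : σ.g t ≤ 1 := by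
  simpa using (σ.sublevel_K 1 le_rfl ht).2.2

@[simp] theorem h_self (t : Y) : σ.h t t = 0 := by simp [h]

theorem h_nonneg {t u : Y} (ht : t ∈ σ.K) (hu : u ∈ σ.X) : 0 ≤ σ.h t u := by
  have htX := σ.K_sub ht
  let ℓ : ℝ →ᵃ[ℝ] Y := AffineMap.lineMap t u
  have hmaps : Set.MapsTo ℓ (Set.Icc 0 1) σ.X := fun s hs => σ.conv.lineMap_mem htX hu hs
  have hconv : ConvexOn ℝ (Set.Icc 0 1) (σ.g ∘ ℓ) :=
    (σ.g_sconv.convexOn.comp_affineMap ℓ).subset hmaps (convex_Icc 0 1)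
  have hderiv : HasDerivWithinAt (σ.g ∘ ℓ) (σ.g' t (u - t)) (Set.Icc 0 1) 0 :=
    (σ.g_diff t ht).comp_hasDerivWithinAt_of_eq 0 AffineMap.hasDerivWithinAt_lineMap hmaps
      (AffineMap.lineMap_apply_zero t u).symm
  have := hconv.le_slope_of_hasDerivWithinAt (by simp) (by simp) one_pos hderiv
  simp only [slope_def_field, Function.comp_apply, AffineMap.lineMap_apply_one,
    AffineMap.lineMap_apply_zero, sub_zero, div_one, ℓ] at this
  unfold h
  linarith

theorem convexOn_h (t : Y) : ConvexOn ℝ σ.X (σ.h t) := by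
  refine ⟨σ.conv, fun x hx y hy a b ha hb hab => ?_⟩
  have := σ.g_sconv.convexOn.2 hx hy ha hb hab
  have hs : a • x + b • y - t = a • (x - t) + b • (y - t) := by
    have ht : t = (a + b) • t := by rw [hab, one_smul]
    nth_rewrite 1 [ht]
    module
  simp only [h, hs, map_add, map_smul, smul_eq_mul] at this ⊢
  have ht : σ.g t = a * σ.g t + b * σ.g t := by rw [← add_mul, hab, one_mul]
  linarith

theorem h_lineMap_le {t u : Y} (ht : t ∈ σ.X) (hu : u ∈ σ.X) {c : ℝ} (hc : c ∈ Set.Icc 0 1) :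
    σ.h t (AffineMap.lineMap t u c) ≤ c * σ.h t u := by
  have := (convexOn_h (σ := σ) t).2 ht hu (sub_nonneg.2 hc.2) hc.1 (sub_add_cancel 1 c)
  rwa [← AffineMap.lineMap_apply_module, h_self, smul_zero, zero_add, smul_eq_mul] at this

theorem h_pos {t u : Y} (ht : t ∈ σ.K) (hu : u ∈ σ.X) (htu : t ≠ u) : 0 < σ.h t u := by
  have htX := σ.K_sub ht
  have h2 : (0 : ℝ) < 1 / 2 := by norm_num
  have hlt := σ.g_sconv.2 htX hu htu h2 h2 (by norm_num)
  have hm := σ.conv htX hu h2.le h2.le (by norm_num)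
  have hnonneg := h_nonneg ht hm
  have hs : (1 / 2 : ℝ) • t + (1 / 2 : ℝ) • u - t = (1 / 2 : ℝ) • (u - t) := by module
  simp only [h, hs, map_smul, smul_eq_mul] at hlt hnonneg ⊢
  linarith

theorem continuousOn_h : ContinuousOn (fun p : Y × Y => σ.h p.1 p.2) (σ.K ×ˢ σ.X) := by
  have hfst : ContinuousOn (fun p : Y × Y => σ.g p.1) (σ.K ×ˢ σ.X) :=
    σ.g_cont.comp continuousOn_fst fun p hp => σ.K_sub hp.1
  have hsnd : ContinuousOn (fun p : Y × Y => σ.g p.2) (σ.K ×ˢ σ.X) :=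
    σ.g_cont.comp continuousOn_snd fun p hp => hp.2
  have hg' : ContinuousOn (fun p : Y × Y => σ.g' p.1) (σ.K ×ˢ σ.X) :=
    σ.g'_cont.comp continuousOn_fst fun p hp => hp.1
  exact hsnd.sub (hfst.add (hg'.clm_apply (continuousOn_snd.sub continuousOn_fst)))

theorem exists_mul_norm_sub_le_h [FiniteDimensional ℝ Y] {K₁ : Set Y} (hK₁closed : IsClosed K₁)
    (hK₁ : K₁ ⊆ interior σ.K) :
    ∃ r > 0, ∃ m > 0, ∀ t ∈ K₁, ∀ u ∈ σ.X \ σ.K, r ≤ ‖u - t‖ ∧ m * ‖u - t‖ ≤ σ.h t u := by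
  have hKc : IsCompact σ.K := Metric.isCompact_of_isClosed_isBounded σ.K_closed σ.K_bdd
  have hK₁K : K₁ ⊆ σ.K := hK₁.trans interior_subset
  have hK₁c : IsCompact K₁ := hKc.of_isClosed_subset hK₁closed hK₁K
  obtain ⟨r, hr, hrK⟩ := hK₁c.exists_cthickening_subset_open isOpen_interior hK₁
  have hball : ∀ t ∈ K₁, ∀ v, ‖v - t‖ ≤ r → v ∈ σ.K := fun t ht v hv =>
    interior_subset (hrK (Metric.mem_cthickening_of_dist_le v t r K₁ ht (by rwa [dist_eq_norm])))
  let P : Set (Y × Y) := (K₁ ×ˢ σ.K) ∩ {p | ‖p.2 - p.1‖ = r}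
  have hP : IsCompact P :=
    (hK₁c.prod hKc).inter_right (isClosed_eq (by fun_prop) continuous_const)
  obtain ⟨m, hm, hmP⟩ : ∃ m, 0 < m ∧ ∀ p ∈ P, m ≤ σ.h p.1 p.2 := by
    refine hP.exists_forall_le' (continuousOn_h.mono fun p hp =>
      ⟨hK₁K hp.1.1, σ.K_sub hp.1.2⟩) fun p hp => h_pos (hK₁K hp.1.1) (σ.K_sub hp.1.2) ?_
    intro heq
    have : ‖p.2 - p.1‖ = r := hp.2
    rw [heq, sub_self, norm_zero] at this
    exact hr.ne this
  refine ⟨r, hr, m / r, by positivity, fun t ht u hu => ?_⟩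
  have hru : r < ‖u - t‖ := not_le.1 fun hle => hu.2 (hball t ht u hle)
  have hpos : 0 < ‖u - t‖ := hr.trans hru
  refine ⟨hru.le, ?_⟩
  set c := r / ‖u - t‖ with hc
  have hc0 : 0 < c := by positivity
  have hc1 : c ≤ 1 := (div_le_one hpos).2 hru.le
  have hv : ‖AffineMap.lineMap t u c - t‖ = r := by
    rw [← dist_eq_norm, dist_lineMap_left, Real.norm_of_nonneg hc0.le, dist_comm, dist_eq_norm, hc,
      div_mul_cancel₀ _ hpos.ne']
  have hle := (hmP (t, _) ⟨⟨ht, hball t ht _ hv.le⟩, hv⟩).trans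
    (h_lineMap_le (σ.K_sub (hK₁K ht)) hu.1 ⟨hc0.le, hc1⟩)
  rw [hc, div_mul_eq_mul_div, le_div_iff₀ hpos] at hle
  rw [div_mul_eq_mul_div, div_le_iff₀ hr]
  linarith

theorem exists_g_le_mul_h [FiniteDimensional ℝ Y] {K₁ : Set Y} (hK₁closed : IsClosed K₁)
    (hK₁ : K₁ ⊆ interior σ.K) :
    ∃ C > 0, ∀ t ∈ K₁, ∀ u ∈ σ.X \ σ.K, σ.g u ≤ C * σ.h t u ∧ 1 ≤ C * σ.h t u := by
  have hKc : IsCompact σ.K := Metric.isCompact_of_isClosed_isBounded σ.K_closed σ.K_bdd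
  obtain ⟨r, hr, m, hm, hrm⟩ := exists_mul_norm_sub_le_h hK₁closed hK₁
  obtain ⟨G, hG⟩ := hKc.exists_bound_of_continuousOn σ.g'_cont
  refine ⟨1 + 1 / (m * r) + |G| / m, by positivity, fun t ht u hu => ?_⟩
  have htK := interior_subset (hK₁ ht)
  obtain ⟨h1, h2⟩ := hrm t ht u hu
  have hh : 0 ≤ σ.h t u := h_nonneg htK hu.1
  have hnorm : ‖u - t‖ ≤ σ.h t u / m := by
    rw [le_div_iff₀ hm]
    linarith
  have hone : 1 ≤ 1 / (m * r) * σ.h t u := by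
    rw [div_mul_eq_mul_div, one_mul, one_le_div (by positivity)]
    nlinarith
  have hG0 : 0 ≤ |G| / m * σ.h t u := by positivity
  have hlin : σ.g' t (u - t) ≤ |G| / m * σ.h t u :=
    calc σ.g' t (u - t) ≤ ‖σ.g' t‖ * ‖u - t‖ := (le_abs_self _).trans ((σ.g' t).le_opNorm _)
      _ ≤ |G| * (σ.h t u / m) := by
        gcongr
        exact (hG t htK).trans (le_abs_self G)
      _ = _ := by ring
  have hgt := g_le_one htK
  have hgu : σ.g u = σ.h t u + σ.g t + σ.g' t (u - t) := by
    simp only [h]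
    ring
  constructor <;> nlinarith

theorem exists_norm_sub_le_mul_h [FiniteDimensional ℝ Y] {E : Type*} [NormedAddCommGroup E]
    {K₁ : Set Y} (hK₁closed : IsClosed K₁) (hK₁ : K₁ ⊆ interior σ.K) {F : Y → E}
    (hF : MemCg σ.X σ.g F) :
    ∃ M > 0, ∀ t ∈ K₁, ∀ u ∈ σ.X \ σ.K, ‖F u - F t‖ ≤ M * σ.h t u := by
  obtain ⟨-, A, hA, hAF⟩ := hF
  obtain ⟨C, hC, hCh⟩ := exists_g_le_mul_h hK₁closed hK₁
  refine ⟨A * C + A * C, by positivity, fun t ht u hu => ?_⟩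
  have htK := interior_subset (hK₁ ht)
  obtain ⟨hgu, hone⟩ := hCh t ht u hu
  calc ‖F u - F t‖ ≤ ‖F u‖ + ‖F t‖ := norm_sub_le _ _
    _ ≤ A * σ.g u + A * σ.g t := add_le_add (hAF u hu.1) (hAF t (σ.K_sub htK))
    _ ≤ A * (C * σ.h t u) + A * (C * σ.h t u) := by
      gcongr
      exact (g_le_one htK).trans hone
    _ = _ := by ring

end GSettingFin

theorem stmt_17
    [FiniteDimensional ℝ Y]
    {E : Type*} [NormedAddCommGroup E] [NormedSpace ℝ E]
    (σ : GSettingFin Y)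
    -- ψ_t² ∈ C(X;ℝ,g) for every t ∈ Y
    (hpsi : ∀ t : Y, MemCg σ.X σ.g (fun u => ‖u - t‖ ^ 2))
    (DL : ℕ → Submodule ℝ (Y → E)) (DS : ℕ → Submodule ℝ (Y → ℝ))
    (L : ∀ n, DL n →ₗ[ℝ] (Y → E)) (S : ∀ n, DS n →ₗ[ℝ] (Y → ℝ))
    -- each S_n is positive
    (hSpos : ∀ n, ∀ f : DS n, (∀ u ∈ σ.X, 0 ≤ f.1 u) → ∀ t ∈ σ.K, 0 ≤ S n f t)
    -- each L_n is dominated by S_n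
    (hdom_mem : ∀ n, ∀ F : DL n, (fun u => ‖F.1 u‖) ∈ DS n)
    (hdom : ∀ n, ∀ F : DL n, ∀ t ∈ σ.K,
      ‖L n F t‖ ≤ S n ⟨fun u => ‖F.1 u‖, hdom_mem n F⟩ t)
    -- C(X;E,g) ⊆ D(L_n) and C(X;ℝ,g) ⊆ D(S_n)
    (hDL : ∀ n, ∀ F : Y → E, MemCg σ.X σ.g F → F ∈ DL n)
    (hDS : ∀ n, ∀ f : Y → ℝ, MemCg σ.X σ.g f → f ∈ DS n)
    -- K₁ a closed subset of the interior of K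
    (K₁ : Set Y) (hK₁closed : IsClosed K₁) (hK₁ : K₁ ⊆ interior σ.K)
    -- each L_n preserves the constants
    (hconst_mem : ∀ n, ∀ c : E, (fun _ : Y => c) ∈ DL n)
    (hconst : ∀ n, ∀ c : E, ∀ t ∈ σ.K, L n ⟨fun _ => c, hconst_mem n c⟩ t = c)
    -- S_n(𝟙)(t) = 1 on K₁
    (hone_mem : ∀ n, (fun _ : Y => (1 : ℝ)) ∈ DS n)
    (hone : ∀ n, ∀ t ∈ K₁, S n ⟨fun _ => 1, hone_mem n⟩ t = 1)
    -- each S_n preserves the continuous linear functionals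
    (hlin : ∀ n, ∀ φ : Y →L[ℝ] ℝ, ∀ hφ : (fun u : Y => φ u) ∈ DS n,
      ∀ t ∈ K₁, S n ⟨fun u => φ u, hφ⟩ t = φ t) :
    ∀ F : Y → E, ∀ hF : MemCg σ.X σ.g F,
      ∃ M > (0 : ℝ), ∀ n : ℕ, ∀ t ∈ K₁,
      ∀ (hψ : (fun u => ‖u - t‖ ^ 2) ∈ DS n) (hg : σ.g ∈ DS n),
      0 < Real.sqrt (S n ⟨fun u => ‖u - t‖ ^ 2, hψ⟩ t) →
      ‖L n ⟨F, hDL n F hF⟩ t - F t‖ ≤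
        2 * modulusOfContinuity σ.K F (Real.sqrt (S n ⟨fun u => ‖u - t‖ ^ 2, hψ⟩ t)) +
          M * (S n ⟨σ.g, hg⟩ t - σ.g t) := by
  intro F hF
  obtain ⟨M, hM, hMF⟩ := GSettingFin.exists_norm_sub_le_mul_h hK₁closed hK₁ hF
  refine ⟨M, hM, fun n t ht hψ hg hγ => ?_⟩
  have htK : t ∈ σ.K := interior_subset (hK₁ ht)
  have : Nontrivial Y := σ.nontrivial
  have hφ : (fun u => σ.g' t u) ∈ DS n :=
    hDS n _ (.continuousLinearMap (exists_one_le_mul_of_memCg_sq_norm_sub hpsi)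
      (by simpa using hpsi 0) _)
  obtain ⟨-, A, hA, hAF⟩ := id hF
  have hFK : ∀ u ∈ σ.K, ‖F u‖ ≤ A := fun u hu =>
    (hAF u (σ.K_sub hu)).trans (mul_le_of_le_one_right hA.le (GSettingFin.g_le_one hu))
  set δ := Real.sqrt (S n ⟨fun u => ‖u - t‖ ^ 2, hψ⟩ t) with hδ
  have hδsq : δ ^ 2 = S n ⟨fun u => ‖u - t‖ ^ 2, hψ⟩ t :=
    Real.sq_sqrt (Real.sqrt_pos.1 hγ).le
  set ω := modulusOfContinuity σ.K F δ with hω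
  have hω0 : 0 ≤ ω := modulusOfContinuity_nonneg _ _ _
  let one : DS n := ⟨fun _ => 1, hone_mem n⟩
  let sq : DS n := ⟨fun u => ‖u - t‖ ^ 2, hψ⟩
  let gS : DS n := ⟨σ.g, hg⟩
  let φ : DS n := ⟨fun u => σ.g' t u, hφ⟩
  let D : DL n := ⟨F, hDL n F hF⟩ - ⟨fun _ => F t, hconst_mem n (F t)⟩
  let H : DS n := gS - (σ.g t - σ.g' t t) • one - φ
  let B : DS n := ω • one + (ω / δ ^ 2) • sq + M • H
  have hLD : L n D t = L n ⟨F, hDL n F hF⟩ t - F t := by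
    rw [map_sub, Pi.sub_apply, hconst n (F t) t htK]
  have hH : ∀ u, H.1 u = σ.h t u := fun u => by
    simp [H, gS, φ, one, GSettingFin.h]
    ring
  have hSH : S n H t = S n gS t - σ.g t := by
    simp only [H, map_sub, map_smul, Pi.sub_apply, Pi.smul_apply, smul_eq_mul]
    rw [hone n t ht, hlin n (σ.g' t) hφ t ht]
    ring
  have hSB : S n B t = 2 * ω + M * (S n gS t - σ.g t) := by
    simp only [B, map_add, map_smul, Pi.add_apply, Pi.smul_apply, smul_eq_mul]
    rw [hSH, hone n t ht, ← hδsq, div_mul_cancel₀ _ (by positivity)]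
    ring
  have hDB : ∀ u ∈ σ.X, ‖D.1 u‖ ≤ B.1 u := fun u hu => by
    have hB : B.1 u = (1 + ‖u - t‖ ^ 2 / δ ^ 2) * ω + M * σ.h t u := by
      rw [← hH u]
      simp [B, one, sq]
      ring
    have hD : D.1 u = F u - F t := rfl
    rw [hB, hD]
    by_cases huK : u ∈ σ.K
    · exact (norm_sub_le_one_add_sq_mul_modulusOfContinuity σ.K_conv hFK hγ htK huK).trans
        (le_add_of_nonneg_right (mul_nonneg hM.le (GSettingFin.h_nonneg htK hu)))
    · exact (hMF t ht u ⟨hu, huK⟩).trans (le_add_of_nonneg_left (by positivity))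
  have hmono := hSpos n (B - ⟨fun u => ‖D.1 u‖, hdom_mem n D⟩)
    (fun u hu => sub_nonneg.2 (hDB u hu)) t htK
  rw [map_sub, Pi.sub_apply, sub_nonneg] at hmono
  rw [← hLD, ← hSB]
  exact (hdom n D t htK).trans hmono
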